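/- arXiv:1801.05582 — 2 statements merged into one kernel-verified Lean document; each statement's English description precedes it below -/
import Mathlib

section
/- Let ν = ν_ac + ν_sing be a compactly supported finite complex measure on ℝ, where ν_ac has a density m that is Hölder continuous of exponent μ > 0 near 0 and integrable, and ν_sing is supported outside a neighborhood of 0. Then the oscillating integral I(t) = ∫ (1 − e^{−its})/s dν(s) can be written as I(t) = I_∞ + b(t) + ε(t), where I_∞ = p.v.∫ m(s)/s ds + iπ m(0) + ∫_{supp ν_sing} (1/s) dν_sing(s) is finite, b(t) = −∫ e^{−its}/s dν_sing(s) is a bounded function of t, and ε(t) → 0 as t → +∞. -/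
open MeasureTheory Filter Complex

theorem norm_exp_neg_I_mul_ofReal (t s : ℝ) : ‖exp (-(I * t * s))‖ = 1 := by
  rw [show -(I * t * s) = ((-(t * s) : ℝ) : ℂ) * I by push_cast; ring, norm_exp_ofReal_mul_I]

theorem integrable_exp_neg_sq : Integrable fun s : ℝ => exp (-(s : ℂ) ^ 2) := by
  simpa using integrable_cexp_neg_mul_sq (b := 1) (by simp)

theorem one_sub_exp_div_eq_intervalIntegral (t : ℝ) {s : ℝ} (hs : s ≠ 0) :
    (1 - exp (-(I * t * s))) / s = ∫ u in (0 : ℝ)..t, I * exp (-(I * u * s)) := by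
  have hs' : (s : ℂ) ≠ 0 := by exact_mod_cast hs
  have h (u : ℝ) : exp (-(I * u * s)) = exp (-(I * s) * u) := by ring_nf
  simp_rw [h]
  rw [intervalIntegral.integral_const_mul, integral_exp_mul_complex (by simp [hs'])]
  simp only [ofReal_zero, mul_zero, exp_zero]
  field_simp
  ring

theorem integral_one_sub_exp_div_mul_exp_neg_sq (t : ℝ) :
    ∫ s : ℝ, (1 - exp (-(I * t * s))) / s * exp (-(s : ℂ) ^ 2) =
      I * (Real.pi : ℂ) ^ (1 / 2 : ℂ) * ((∫ u in (0 : ℝ)..t, Real.exp (-(1 / 4) * u ^ 2) : ℝ) : ℂ) := by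
  have h_inner (u : ℝ) : ∫ s : ℝ, I * exp (-(I * u * s)) * exp (-(s : ℂ) ^ 2) =
      I * (Real.pi : ℂ) ^ (1 / 2 : ℂ) * ((Real.exp (-(1 / 4) * u ^ 2) : ℝ) : ℂ) := by
    have := fourierIntegral_gaussian (b := 1) (by simp) (-u : ℂ)
    simp_rw [mul_assoc I (exp _), integral_const_mul]
    rw [mul_assoc]
    congr 1
    convert this using 1
    · simp
    · push_cast
      simp only [div_one]
      ring_nf
  have h_swap : ∫ u in (0 : ℝ)..t, ∫ s : ℝ, I * exp (-(I * u * s)) * exp (-(s : ℂ) ^ 2) =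
      ∫ s : ℝ, ∫ u in (0 : ℝ)..t, I * exp (-(I * u * s)) * exp (-(s : ℂ) ^ 2) := by
    refine intervalIntegral_integral_swap ?_
    have : IsFiniteMeasure (volume.restrict (Set.uIoc 0 t)) :=
      ⟨by simp [Set.uIoc]⟩
    have hg : Integrable (fun z : ℝ × ℝ => (1 : ℂ) * exp (-(z.2 : ℂ) ^ 2))
        ((volume.restrict (Set.uIoc 0 t)).prod volume) :=
      Integrable.mul_prod (f := fun _ : ℝ => (1 : ℂ)) (integrable_const _) integrable_exp_neg_sq
    refine hg.mono (by unfold Function.uncurry; fun_prop) (.of_forall fun z => ?_)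
    simp [Function.uncurry, norm_exp_neg_I_mul_ofReal]
  rw [← intervalIntegral.integral_ofReal, ← intervalIntegral.integral_const_mul]
  simp_rw [← h_inner]
  rw [h_swap]
  refine integral_congr_ae ?_
  filter_upwards [Measure.ae_ne volume (0 : ℝ)] with s hs
  rw [intervalIntegral.integral_mul_const, one_sub_exp_div_eq_intervalIntegral t hs]

theorem tendsto_integral_one_sub_exp_div_mul_exp_neg_sq :
    Tendsto (fun t : ℝ => ∫ s : ℝ, (1 - exp (-(I * t * s))) / s * exp (-(s : ℂ) ^ 2))
      atTop (nhds (Real.pi * I)) := by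
  simp_rw [integral_one_sub_exp_div_mul_exp_neg_sq]
  have h := intervalIntegral_tendsto_integral_Ioi (μ := volume) (l := atTop) 0
    (integrable_exp_neg_mul_sq (b := 1 / 4) (by norm_num)).integrableOn tendsto_id
  rw [integral_gaussian_Ioi] at h
  have h_val : √(Real.pi / (1 / 4)) / 2 = √Real.pi := by
    rw [show Real.pi / (1 / 4) = 2 ^ 2 * Real.pi by ring, Real.sqrt_mul (by norm_num),
      Real.sqrt_sq (by norm_num)]
    ring
  rw [h_val] at h
  have h_pow : (Real.pi : ℂ) ^ (1 / 2 : ℂ) = ((√Real.pi : ℝ) : ℂ) := by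
    rw [Real.sqrt_eq_rpow, ofReal_cpow Real.pi_pos.le]
    norm_num
  have h_lim := ((continuous_ofReal.tendsto _).comp h).const_mul (I * (Real.pi : ℂ) ^ (1 / 2 : ℂ))
  have h_const : I * (Real.pi : ℂ) ^ (1 / 2 : ℂ) * ((√Real.pi : ℝ) : ℂ) = Real.pi * I := by
    rw [h_pow, mul_assoc, ← ofReal_mul, Real.mul_self_sqrt Real.pi_pos.le, mul_comm]
  rw [h_const] at h_lim
  exact h_lim

theorem tendsto_integral_exp_neg_I_mul (f : ℝ → ℂ) :
    Tendsto (fun t : ℝ => ∫ s : ℝ, exp (-(I * t * s)) * f s) atTop (nhds 0) := by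
  have h_scale : Tendsto (fun t : ℝ => t / (2 * Real.pi)) atTop (cocompact ℝ) :=
    (tendsto_id.atTop_div_const (by positivity)).mono_right atTop_le_cocompact
  refine ((Real.tendsto_integral_exp_smul_cocompact f).comp h_scale).congr fun t => ?_
  refine integral_congr_ae (.of_forall fun s => ?_)
  have hpi : (Real.pi : ℂ) ≠ 0 := by exact_mod_cast Real.pi_ne_zero
  simp only [Circle.smul_def, Real.fourierChar_apply, smul_eq_mul]
  congr 2
  push_cast
  field_simp

theorem intervalIntegrable_abs_rpow {r : ℝ} (hr : -1 < r) (a b : ℝ) :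
    IntervalIntegrable (fun s : ℝ => |s| ^ r) volume a b := by
  refine intervalIntegrable_of_even (fun x => by simp) fun x hx => ?_
  refine (intervalIntegral.intervalIntegrable_rpow' hr).congr fun s hs => ?_
  rw [Set.uIoc_of_le hx.le] at hs
  simp only [abs_of_pos hs.1]

theorem norm_sub_exp_neg_sq_div_le {a : ℝ} {C p : ℝ} {m : ℝ → ℂ}
    (hm : ∀ s : ℝ, |s| ≤ a → ‖m s - m 0‖ ≤ C * |s| ^ p) {s : ℝ} (hs : |s| ≤ a) (hs0 : s ≠ 0) :
    ‖(m s - m 0 * exp (-(s : ℂ) ^ 2)) / s‖ ≤ C * |s| ^ (p - 1) + ‖m 0‖ * a := by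
  have hpos : 0 < |s| := abs_pos.mpr hs0
  have h_exp : ‖1 - exp (-(s : ℂ) ^ 2)‖ ≤ |s| ^ 2 := by
    rw [show 1 - exp (-(s : ℂ) ^ 2) = ((1 - Real.exp (-s ^ 2) : ℝ) : ℂ) by push_cast; rfl,
      norm_real, Real.norm_eq_abs, sq_abs, abs_le]
    have h1 := Real.add_one_le_exp (-s ^ 2)
    have h2 : Real.exp (-s ^ 2) ≤ 1 := Real.exp_le_one_iff.mpr (by nlinarith [sq_nonneg s])
    constructor <;> nlinarith [sq_nonneg s]
  rw [norm_div, norm_real, Real.norm_eq_abs, div_le_iff₀ hpos]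
  calc ‖m s - m 0 * exp (-(s : ℂ) ^ 2)‖
      = ‖(m s - m 0) + m 0 * (1 - exp (-(s : ℂ) ^ 2))‖ := by ring_nf
    _ ≤ C * |s| ^ p + ‖m 0‖ * |s| ^ 2 := by
        refine (norm_add_le _ _).trans (add_le_add (hm s hs) ?_)
        rw [norm_mul]
        gcongr
    _ ≤ C * |s| ^ p + ‖m 0‖ * (a * |s|) := by
        rw [sq]
        gcongr
    _ = (C * |s| ^ (p - 1) + ‖m 0‖ * a) * |s| := by
        rw [Real.rpow_sub_one hpos.ne']
        field_simp

theorem integrable_sub_exp_neg_sq_div {a : ℝ} (ha : 0 < a) {C p : ℝ} (hp : 0 < p) {m : ℝ → ℂ}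
    (hm_int : Integrable m) (hm : ∀ s : ℝ, |s| ≤ a → ‖m s - m 0‖ ≤ C * |s| ^ p) :
    Integrable fun s : ℝ => (m s - m 0 * exp (-(s : ℂ) ^ 2)) / s := by
  have h_num : Integrable fun s : ℝ => m s - m 0 * exp (-(s : ℂ) ^ 2) :=
    hm_int.sub (integrable_exp_neg_sq.const_mul _)
  have h_meas : AEStronglyMeasurable (fun s : ℝ => (m s - m 0 * exp (-(s : ℂ) ^ 2)) / s) :=
    (h_num.1.aemeasurable.div (by fun_prop)).aestronglyMeasurable
  rw [← integrableOn_univ, ← Set.union_compl_self (Set.Ioc (-a) a)]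
  refine IntegrableOn.union ?_ ?_
  · have h_pow := (intervalIntegrable_iff_integrableOn_Ioc_of_le (by linarith)).mp
      (intervalIntegrable_abs_rpow (r := p - 1) (by linarith) (-a) a)
    refine Integrable.mono' ((h_pow.const_mul C).add (integrable_const (‖m 0‖ * a)))
      h_meas.restrict ?_
    filter_upwards [ae_restrict_mem measurableSet_Ioc, ae_restrict_of_ae (Measure.ae_ne volume 0)]
      with s hs hs0
    exact norm_sub_exp_neg_sq_div_le hm (abs_le.mpr ⟨hs.1.le, hs.2⟩) hs0
  · refine Integrable.mono' ((h_num.norm.mul_const a⁻¹).integrableOn) h_meas.restrict ?_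
    filter_upwards [ae_restrict_mem measurableSet_Ioc.compl] with s hs
    have hs' : a ≤ |s| := by
      by_contra! h
      exact hs ⟨(abs_lt.mp h).1, (abs_lt.mp h).2.le⟩
    rw [norm_div, norm_real, Real.norm_eq_abs, div_eq_mul_inv]
    gcongr

theorem integral_eq_zero_of_odd {f : ℝ → ℂ} (hf : ∀ s, f (-s) = -f s) :
    ∫ s, f s = 0 := by
  have h := integral_neg_eq_self f volume
  simp_rw [hf, integral_neg] at h
  exact self_eq_neg.mp h.symm

theorem tendsto_setIntegral_le_abs {f : ℝ → ℂ} (hf : Integrable f) :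
    Tendsto (fun δ : ℝ => ∫ s in {s : ℝ | δ ≤ |s|}, f s)
      (nhdsWithin 0 (Set.Ioi 0)) (nhds (∫ s, f s)) := by
  refine AECover.integral_tendsto_of_countably_generated ⟨?_, fun δ => ?_⟩ hf
  · filter_upwards [Measure.ae_ne volume (0 : ℝ)] with s hs
    filter_upwards [nhdsWithin_le_nhds (Iio_mem_nhds (abs_pos.mpr hs))] with δ hδ
    exact (Set.mem_Iio.mp hδ).le
  · exact measurableSet_le measurable_const measurable_id.abs

theorem tendsto_principalValue {m : ℝ → ℂ}
    (h_int : Integrable fun s : ℝ => (m s - m 0 * exp (-(s : ℂ) ^ 2)) / s) :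
    Tendsto (fun δ : ℝ => ∫ s in {s : ℝ | δ ≤ |s|}, m s / s) (nhdsWithin 0 (Set.Ioi 0))
      (nhds (∫ s : ℝ, (m s - m 0 * exp (-(s : ℂ) ^ 2)) / s)) := by
  refine (tendsto_setIntegral_le_abs h_int).congr' ?_
  filter_upwards [self_mem_nhdsWithin] with δ hδ
  have hδ : 0 < δ := hδ
  have hS : MeasurableSet {s : ℝ | δ ≤ |s|} := measurableSet_le measurable_const measurable_id.abs
  have h_odd : ∫ s in {s : ℝ | δ ≤ |s|}, m 0 * exp (-(s : ℂ) ^ 2) / s = 0 := by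
    rw [← integral_indicator hS]
    refine integral_eq_zero_of_odd fun s => ?_
    by_cases hs : δ ≤ |s|
    · rw [Set.indicator_of_mem (show -s ∈ {s : ℝ | δ ≤ |s|} by simpa using hs),
        Set.indicator_of_mem (show s ∈ {s : ℝ | δ ≤ |s|} from hs)]
      push_cast
      rw [neg_sq, div_neg]
    · rw [Set.indicator_of_notMem (show -s ∉ {s : ℝ | δ ≤ |s|} by simpa using hs),
        Set.indicator_of_notMem (show s ∉ {s : ℝ | δ ≤ |s|} from hs), neg_zero]
  have h_gauss : IntegrableOn (fun s : ℝ => m 0 * exp (-(s : ℂ) ^ 2) / s) {s : ℝ | δ ≤ |s|} := by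
    refine Integrable.mono' ((integrable_exp_neg_sq.const_mul (m 0)).norm.mul_const δ⁻¹).integrableOn
      (Measurable.aestronglyMeasurable (by fun_prop)) ?_
    filter_upwards [ae_restrict_mem hS] with s hs
    have hs : δ ≤ |s| := hs
    rw [norm_div, norm_real, Real.norm_eq_abs, div_eq_mul_inv]
    gcongr
  rw [← add_zero (∫ s in {s : ℝ | δ ≤ |s|}, _), ← h_odd, ← integral_add h_int.integrableOn h_gauss]
  congr 1 with s
  ring

theorem norm_one_sub_exp_div_le (t s : ℝ) : ‖(1 - exp (-(I * t * s))) / s‖ ≤ |t| := by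
  rw [norm_div, norm_sub_rev, norm_real, Real.norm_eq_abs]
  refine div_le_of_le_mul₀ (abs_nonneg _) (abs_nonneg _) ?_
  have h := Real.norm_exp_I_mul_ofReal_sub_one_le (x := -(t * s))
  rw [norm_neg, norm_mul, Real.norm_eq_abs, Real.norm_eq_abs] at h
  rwa [show I * ((-(t * s) : ℝ) : ℂ) = -(I * t * s) by push_cast; ring] at h

theorem tendsto_integral_one_sub_exp_div {m : ℝ → ℂ}
    (h_int : Integrable fun s : ℝ => (m s - m 0 * exp (-(s : ℂ) ^ 2)) / s) :
    Tendsto (fun t : ℝ => ∫ s : ℝ, (1 - exp (-(I * t * s))) / s * m s) atTop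
      (nhds ((∫ s : ℝ, (m s - m 0 * exp (-(s : ℂ) ^ 2)) / s) + Real.pi * I * m 0)) := by
  have h := ((tendsto_integral_exp_neg_I_mul
    fun s : ℝ => (m s - m 0 * exp (-(s : ℂ) ^ 2)) / s).const_sub
      (∫ s : ℝ, (m s - m 0 * exp (-(s : ℂ) ^ 2)) / s)).add
    (tendsto_integral_one_sub_exp_div_mul_exp_neg_sq.mul_const (m 0))
  rw [sub_zero] at h
  refine h.congr fun t => ?_
  have h_osc : Integrable fun s : ℝ =>
      exp (-(I * t * s)) * ((m s - m 0 * exp (-(s : ℂ) ^ 2)) / s) :=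
    h_int.bdd_mul (c := 1) (by fun_prop) (.of_forall fun s => (norm_exp_neg_I_mul_ofReal t s).le)
  have h_gauss : Integrable fun s : ℝ => (1 - exp (-(I * t * s))) / s * exp (-(s : ℂ) ^ 2) :=
    integrable_exp_neg_sq.bdd_mul (c := |t|) (Measurable.aestronglyMeasurable (by fun_prop))
      (.of_forall fun s => norm_one_sub_exp_div_le t s)
  rw [← integral_sub h_int h_osc, ← integral_mul_const]
  refine (integral_add (h_int.sub h_osc) (h_gauss.mul_const _)).symm.trans ?_
  congr 1 with s
  simp only [Pi.sub_apply]
  ring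

/-- Decomposition of the oscillating integral `I(t) = ∫ (1 − e^{−its})/s dν(s)` for a
compactly supported measure `ν = m(s) ds + ν_sing`, where the density `m` is Hölder
continuous near 0 and the singular part (represented as `g dμ` for a finite measure `μ`)
is supported outside a neighborhood of 0:
`I(t) = I_∞ + b(t) + ε(t)` with `I_∞ = p.v.∫ m(s)/s ds + iπ m(0) + ∫ g(s)/s dμ`,
`b(t) = −∫ e^{−its} g(s)/s dμ` bounded in `t`, and `ε(t) → 0` as `t → +∞`. -/
theorem oscillating_integral_decomposition
    (a : ℝ) (ha : 0 < a)
    (m : ℝ → ℂ) (hm_int : Integrable m) (hm_supp : HasCompactSupport m)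
    (C μexp : ℝ) (hμexp : 0 < μexp)
    (hHolder : ∀ s : ℝ, |s| ≤ a → ‖m s - m 0‖ ≤ C * |s| ^ μexp)
    (μ : Measure ℝ) [IsFiniteMeasure μ] (g : ℝ → ℂ) (hg : Integrable g μ)
    (hμ_supp : ∀ᵐ s ∂μ, a ≤ |s|) (hμ_comp : ∃ R : ℝ, ∀ᵐ s ∂μ, |s| ≤ R) :
    ∃ PV : ℂ,
      Tendsto (fun δ : ℝ => ∫ s in {s : ℝ | δ ≤ |s|}, m s / s)
        (nhdsWithin 0 (Set.Ioi 0)) (nhds PV) ∧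
      ∃ ε : ℝ → ℂ, Tendsto ε atTop (nhds 0) ∧
      (∃ M : ℝ, ∀ t : ℝ, ‖∫ s, Complex.exp (-(Complex.I * t * s)) / s * g s ∂μ‖ ≤ M) ∧
      ∀ t : ℝ,
        ((∫ s : ℝ, (1 - Complex.exp (-(Complex.I * t * s))) / s * m s) +
          ∫ s, (1 - Complex.exp (-(Complex.I * t * s))) / s * g s ∂μ) =
        (PV + Real.pi * Complex.I * m 0 + ∫ s, g s / s ∂μ) +
          (-∫ s, Complex.exp (-(Complex.I * t * s)) / s * g s ∂μ) + ε t := by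
  have h_int := integrable_sub_exp_neg_sq_div ha hμexp hm_int hHolder
  have h_inv : ∀ᵐ s : ℝ ∂μ, ‖(s : ℂ)⁻¹‖ ≤ a⁻¹ := by
    filter_upwards [hμ_supp] with s hs
    rw [norm_inv, norm_real, Real.norm_eq_abs]
    gcongr
  have h_osc_le (t : ℝ) : ∀ᵐ s : ℝ ∂μ, ‖Complex.exp (-(Complex.I * t * s)) / s‖ ≤ a⁻¹ := by
    filter_upwards [h_inv] with s hs
    rwa [div_eq_mul_inv, norm_mul, norm_exp_neg_I_mul_ofReal, one_mul]
  have h_div : Integrable (fun s : ℝ => g s / s) μ := by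
    simpa only [div_eq_mul_inv] using hg.mul_bdd (Measurable.aestronglyMeasurable (by fun_prop)) h_inv
  have h_osc (t : ℝ) : Integrable (fun s : ℝ => Complex.exp (-(Complex.I * t * s)) / s * g s) μ :=
    hg.bdd_mul (Measurable.aestronglyMeasurable (by fun_prop)) (h_osc_le t)
  refine ⟨_, tendsto_principalValue h_int, _,
    tendsto_sub_nhds_zero_iff.mpr (tendsto_integral_one_sub_exp_div h_int),
    ⟨∫ s, a⁻¹ * ‖g s‖ ∂μ, fun t => ?_⟩, fun t => ?_⟩
  · refine norm_integral_le_of_norm_le (hg.norm.const_mul _) ?_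
    filter_upwards [h_osc_le t] with s hs
    rw [norm_mul]
    gcongr
  · have h_split : ∫ s, (1 - Complex.exp (-(Complex.I * t * s))) / s * g s ∂μ =
        (∫ s, g s / s ∂μ) - ∫ s, Complex.exp (-(Complex.I * t * s)) / s * g s ∂μ := by
      rw [← integral_sub h_div (h_osc t)]
      congr 1 with s
      ring
    rw [h_split]
    ring
end

section
/- Fix λ ≠ 0, n ≥ 1, and k ∈ ℤ. Let ρ : ℝ² → ℂ be smooth and bounded with bounded derivatives. Then the function α(y,s) = (1/λ) ∫₀¹ τ^{n−1−ik/λ} ρ(y + (τ−1)s/λ, τs) dτ is a smooth solution on ℝ² of the singular differential equation s(∂_y α + λ ∂_s α) + (λn − ik)α = ρ. -/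
open MeasureTheory Filter Topology Set Function

universe u

/-- A jointly continuous function is bounded, locally uniformly in the first variable, when the
second variable ranges over a compact set. -/
theorem exists_nhds_norm_le_of_continuous_uncurry {X T G : Type*} [TopologicalSpace X]
    [TopologicalSpace T] [SeminormedAddCommGroup G] {f : X → T → G}
    (hf : Continuous (uncurry f)) {K : Set T}
    (hK : IsCompact K) (x₀ : X) :
    ∃ C : ℝ, ∃ s ∈ 𝓝 x₀, ∀ x ∈ s, ∀ t ∈ K, ‖f x t‖ ≤ C := by
  obtain ⟨C, hC⟩ := hK.exists_bound_of_continuousOn (f := f x₀)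
    (hf.comp (Continuous.prodMk_right x₀)).continuousOn
  refine ⟨C + 1, {x | ∀ t ∈ K, ‖f x t‖ ≤ C + 1}, ?_, fun x hx ↦ hx⟩
  refine hK.eventually_forall_of_forall_eventually fun t ht ↦ ?_
  have h : ‖uncurry f (x₀, t)‖ < C + 1 := (hC t ht).trans_lt (lt_add_one C)
  filter_upwards [hf.norm.continuousAt.eventually_lt continuousAt_const h] with z hz
  exact hz.le

section ParametricIntegral

variable {𝕜 E G : Type*} [NormedField 𝕜] [NormedAddCommGroup E] [NormedSpace ℝ E]
  [NormedAddCommGroup G] [NormedSpace ℝ G]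

theorem ContDiff.uncurry_fderiv_left {f : E → ℝ → G} (hf : ContDiff ℝ (⊤ : ℕ∞) (uncurry f)) :
    ContDiff ℝ (⊤ : ℕ∞) (uncurry fun x t ↦ fderiv ℝ (f · t) x) := by
  have h : ContDiff ℝ (⊤ : ℕ∞) (uncurry fun (p : E × ℝ) (x : E) ↦ f x p.2) :=
    hf.comp (contDiff_snd.prodMk (contDiff_snd.comp contDiff_fst))
  exact h.fderiv contDiff_fst (by simp)

variable [NormedSpace 𝕜 G] [SMulCommClass ℝ 𝕜 G]

theorem hasFDerivAt_intervalIntegral_smul {w : ℝ → 𝕜} {a b : ℝ}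
    (hw : IntervalIntegrable w volume a b) {f : E → ℝ → G}
    (hf : ContDiff ℝ (⊤ : ℕ∞) (uncurry f)) (x₀ : E) :
    HasFDerivAt (fun x ↦ ∫ t in a..b, w t • f x t)
      (∫ t in a..b, w t • fderiv ℝ (f · t) x₀) x₀ := by
  have hf' := hf.uncurry_fderiv_left
  obtain ⟨C, s, hs, hC⟩ :=
    exists_nhds_norm_le_of_continuous_uncurry hf'.continuous (isCompact_uIcc (a := a) (b := b)) x₀
  have hc (x : E) : Continuous (f x) := hf.continuous.comp (Continuous.prodMk_right x)
  have hc' : Continuous fun t ↦ fderiv ℝ (f · t) x₀ :=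
    hf'.continuous.comp (Continuous.prodMk_right x₀)
  refine intervalIntegral.hasFDerivAt_integral_of_dominated_of_fderiv_le
    (F' := fun x t ↦ w t • fderiv ℝ (f · t) x) (bound := fun t ↦ ‖w t‖ * C) hs
    (.of_forall fun x ↦ ?_) (hw.smul_continuousOn (hc x₀).continuousOn) ?_
    (.of_forall fun t ht x hx ↦ ?_) (hw.norm.mul_const C) (.of_forall fun t _ x _ ↦ ?_)
  · exact hw.def'.aestronglyMeasurable.smul (hc x).aestronglyMeasurable
  · exact hw.def'.aestronglyMeasurable.smul hc'.aestronglyMeasurable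
  · rw [norm_smul]
    exact mul_le_mul_of_nonneg_left (hC x hx t (uIoc_subset_uIcc ht)) (norm_nonneg _)
  · have h : Differentiable ℝ (f · t) :=
      (hf.comp (contDiff_prodMk_left t)).differentiable (by simp)
    exact (h x).hasFDerivAt.const_smul (w t)

end ParametricIntegral

/-- Integrating a jointly smooth function against an integrable weight gives a smooth function of
the parameter. -/
theorem contDiff_intervalIntegral_smul {𝕜 : Type*} {E G : Type u} [NormedField 𝕜]
    [NormedAddCommGroup E] [NormedSpace ℝ E] [NormedAddCommGroup G] [NormedSpace ℝ G]
    [NormedSpace 𝕜 G] [SMulCommClass ℝ 𝕜 G] {w : ℝ → 𝕜} {a b : ℝ}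
    (hw : IntervalIntegrable w volume a b) {f : E → ℝ → G}
    (hf : ContDiff ℝ (⊤ : ℕ∞) (uncurry f)) :
    ContDiff ℝ (⊤ : ℕ∞) fun x ↦ ∫ t in a..b, w t • f x t := by
  refine contDiff_infty.2 fun m ↦ ?_
  induction m generalizing G with
  | zero =>
    exact contDiff_zero.2 (continuous_iff_continuousAt.2 fun x ↦
      (hasFDerivAt_intervalIntegral_smul hw hf x).continuousAt)
  | succ m ih =>
    exact (contDiff_succ_iff_hasFDerivAt (n := m)).2
      ⟨_, ih hf.uncurry_fderiv_left, hasFDerivAt_intervalIntegral_smul hw hf⟩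

/-- The explicit formula `α(y,s) = (1/λ)∫₀¹ τ^{n−1−ik/λ} ρ(y+(τ−1)s/λ, τs) dτ`
gives a smooth solution of the cohomological equation
`s(∂_y α + λ ∂_s α) + (λn − ik)α = ρ` on `ℝ²`. -/
theorem cohomological_equation_solution
    (lam : ℝ) (hlam : lam ≠ 0) (n : ℕ) (hn : 1 ≤ n) (k : ℤ)
    (ρ : ℝ × ℝ → ℂ) (hρ : ContDiff ℝ (⊤ : ℕ∞) ρ)
    (hρbdd : ∀ i : ℕ, ∃ M : ℝ, ∀ p : ℝ × ℝ, ‖iteratedFDeriv ℝ i ρ p‖ ≤ M)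
    (α : ℝ × ℝ → ℂ)
    (hα : ∀ y s : ℝ, α (y, s) =
      (1 / (lam : ℂ)) * ∫ τ in (0:ℝ)..1,
        (τ : ℂ) ^ (((n : ℂ) - 1) - Complex.I * k / lam) *
          ρ (y + (τ - 1) * s / lam, τ * s)) :
    ContDiff ℝ (⊤ : ℕ∞) α ∧
    ∀ y s : ℝ,
      (s : ℂ) * (fderiv ℝ α (y, s) (1, 0) + (lam : ℂ) * fderiv ℝ α (y, s) (0, 1)) +
        ((lam * n : ℝ) - Complex.I * k) * α (y, s) = ρ (y, s) := by
  have hlam' : (lam : ℂ) ≠ 0 := Complex.ofReal_ne_zero.2 hlam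
  set c : ℂ := ((n : ℂ) - 1) - Complex.I * k / lam with hc
  have hcre : c.re = n - 1 := by
    have : Complex.I * k / lam = ((k / lam : ℝ) : ℂ) * Complex.I := by push_cast; ring
    rw [hc, this]
    simp
  have hn' : (1 : ℝ) ≤ n := by exact_mod_cast hn
  have hw : IntervalIntegrable (fun τ : ℝ ↦ (τ : ℂ) ^ c) volume 0 1 :=
    intervalIntegral.intervalIntegrable_cpow' (by linarith)
  set f : ℝ × ℝ → ℝ → ℂ := fun p τ ↦ ρ (p.1 + (τ - 1) * p.2 / lam, τ * p.2) with hf_def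
  have hf : ContDiff ℝ (⊤ : ℕ∞) (uncurry f) := hρ.comp (by fun_prop)
  have hα' : α = fun p ↦ (1 / (lam : ℂ)) * ∫ τ in (0:ℝ)..1, (τ : ℂ) ^ c • f p τ :=
    funext fun p ↦ hα p.1 p.2
  refine ⟨hα' ▸ contDiff_const.mul (contDiff_intervalIntegral_smul hw hf), fun y s ↦ ?_⟩
  have hfd : HasFDerivAt α ((1 / (lam : ℂ)) •
      ∫ τ in (0:ℝ)..1, (τ : ℂ) ^ c • fderiv ℝ (f · τ) (y, s)) (y, s) :=
    hα' ▸ (hasFDerivAt_intervalIntegral_smul hw hf (y, s)).const_mul _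
  have hρd : Differentiable ℝ ρ := hρ.differentiable (by simp)
  have hint : IntervalIntegrable (fun τ : ℝ ↦ (τ : ℂ) ^ c • fderiv ℝ (f · τ) (y, s)) volume 0 1 :=
    hw.smul_continuousOn
      (hf.uncurry_fderiv_left.continuous.comp (Continuous.prodMk_right (y, s))).continuousOn
  set L : ℝ → ℝ × ℝ →L[ℝ] ℂ := fun τ ↦ fderiv ℝ ρ (y + (τ - 1) * s / lam, τ * s) with hL
  have hLc : Continuous L := (hρ.continuous_fderiv (by simp)).comp (by fun_prop)
  have hfL (τ : ℝ) (v : ℝ × ℝ) :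
      fderiv ℝ (f · τ) (y, s) v = L τ (v.1 + (τ - 1) * v.2 / lam, τ * v.2) := by
    have h : HasFDerivAt (fun p : ℝ × ℝ ↦ (p.1 + (τ - 1) * p.2 / lam, τ * p.2))
        ((ContinuousLinearMap.fst ℝ ℝ ℝ + ((τ - 1) / lam) • ContinuousLinearMap.snd ℝ ℝ ℝ).prod
          (τ • ContinuousLinearMap.snd ℝ ℝ ℝ)) (y, s) := by
      convert ContinuousLinearMap.hasFDerivAt (𝕜 := ℝ) _ using 1
      ext p <;> simp; ring
    have h2 := (hρd _).hasFDerivAt.comp (y, s) h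
    rw [show (f · τ) = ρ ∘ fun p : ℝ × ℝ ↦ (p.1 + (τ - 1) * p.2 / lam, τ * p.2) from rfl,
      h2.fderiv]
    simp only [ContinuousLinearMap.comp_apply, hL]
    congr 2
    simp; ring
  have hdir : fderiv ℝ α (y, s) (1, 0) + (lam : ℂ) * fderiv ℝ α (y, s) (0, 1) =
      fderiv ℝ α (y, s) (1, lam) := by
    have : ((1, lam) : ℝ × ℝ) = (1, 0) + lam • (0, 1) := by simp
    rw [this, map_add, map_smul, Complex.real_smul]
  have hg (τ : ℝ) : HasDerivAt (f (y, s)) (L τ (s / lam, s)) τ := by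
    have h : HasDerivAt (fun τ : ℝ ↦ (y + (τ - 1) * s / lam, τ * s)) (s / lam, s) τ := by
      refine HasDerivAt.prodMk ?_ ?_
      · simpa using ((((hasDerivAt_id τ).sub_const 1).mul_const s).div_const lam).const_add y
      · simpa using (hasDerivAt_id τ).mul_const s
    exact (hρd _).hasFDerivAt.comp_hasDerivAt τ h
  have hc1 : 0 < (c + 1).re := by simp [hcre]; linarith
  have hc0 : c + 1 ≠ 0 := fun h ↦ by simp [h] at hc1
  have hparts := intervalIntegral.integral_mul_deriv_eq_deriv_mul_of_hasDerivAt
    (a := 0) (b := 1) (u := fun τ : ℝ ↦ (τ : ℂ) ^ (c + 1)) (v := f (y, s))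
    (u' := fun τ ↦ (c + 1) * (τ : ℂ) ^ c) (v' := fun τ ↦ L τ (s / lam, s))
    (Complex.continuous_ofReal_cpow_const hc1).continuousOn
    (fun τ _ ↦ (hg τ).continuousAt.continuousWithinAt)
    (fun τ hτ ↦ by
      simpa using hasDerivAt_ofReal_cpow_const
        (show τ ≠ 0 by simp at hτ; exact hτ.1.ne') hc0)
    (fun τ _ ↦ hg τ) (hw.const_mul _)
    ((hLc.clm_apply continuous_const).intervalIntegrable _ _)
  have hmain : (s : ℂ) * fderiv ℝ α (y, s) (1, lam) =
      ∫ τ in (0:ℝ)..1, (τ : ℂ) ^ (c + 1) * L τ (s / lam, s) := by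
    rw [hfd.fderiv, smul_apply, smul_eq_mul,
      ContinuousLinearMap.intervalIntegral_apply hint, ← mul_assoc,
      ← intervalIntegral.integral_const_mul]
    refine intervalIntegral.integral_congr_ae (.of_forall fun τ hτ ↦ ?_)
    have hτ0 : (τ : ℂ) ≠ 0 := by
      simp at hτ
      exact_mod_cast hτ.1.ne'
    have hv : ((1 + (τ - 1) * lam / lam, τ * lam) : ℝ × ℝ) = (τ, τ * lam) := by
      rw [mul_div_cancel_right₀ _ hlam]; simp
    have e1 : L τ (τ, τ * lam) = (τ : ℂ) * L τ (1, lam) := by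
      rw [← Complex.real_smul, ← map_smul]; simp
    have e2 : L τ (s / lam, s) = ((s / lam : ℝ) : ℂ) * L τ (1, lam) := by
      rw [← Complex.real_smul, ← map_smul]; simp [div_mul_cancel₀ _ hlam]
    rw [smul_apply, hfL, hv, e1, e2, Complex.cpow_add _ _ hτ0,
      Complex.cpow_one, smul_eq_mul]
    push_cast
    ring
  have hcl : ((lam * n : ℝ) : ℂ) - Complex.I * k = (c + 1) * lam := by
    rw [hc]; push_cast; field_simp; ring
  have hf1 : f (y, s) 1 = ρ (y, s) := by simp [hf_def]
  have hαys : α (y, s) = (1 / (lam : ℂ)) * ∫ τ in (0:ℝ)..1, (τ : ℂ) ^ c * f (y, s) τ := hα y s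
  rw [hdir, hmain, hparts, hcl, hαys, hf1]
  simp only [mul_assoc, intervalIntegral.integral_const_mul]
  rw [Complex.ofReal_zero, Complex.zero_cpow hc0]
  simp
  field_simp
  ring
end
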